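/- arXiv:1405.3422 — 2 statements merged into one kernel-verified Lean document; each statement's English description precedes it below -/
import Mathlib

section
/- Let k ≥ 7 be a natural number and let G be a finite simple graph with maximum degree at most k. Suppose G contains pairwise distinct vertices u, v_1, …, v_{p+1}, x_1, …, x_p with p ≥ 1 such that: every v_i (1 ≤ i ≤ p+1) is adjacent to u; v_i x_i and x_i v_{i+1} are edges of G for all 1 ≤ i ≤ p; d(v_1) = d(v_{p+1}) = 2; and d(v_i) = 3 for all 2 ≤ i ≤ p. Let L be a list assignment on the vertices and edges of G with |L(x)| ≥ k + 1 for every vertex and every edge x. If the graph obtained from G by deleting the vertices v_1, …, v_{p+1} admits a proper L-total-coloring, then G admits a proper L-total-coloring. -/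
/-- A proper `L`-total-coloring of `G`: every vertex gets a color from its list,
every edge of `G` gets a color from its list, adjacent vertices receive distinct
colors, distinct edges sharing an endpoint receive distinct colors, and every edge
receives a color distinct from the colors of both of its endpoints. -/
def IsProperTotalColoring {V : Type*} (G : SimpleGraph V)
    (Lv : V → Finset ℕ) (Le : Sym2 V → Finset ℕ)
    (cv : V → ℕ) (ce : Sym2 V → ℕ) : Prop :=
  (∀ v, cv v ∈ Lv v) ∧
  (∀ e ∈ G.edgeSet, ce e ∈ Le e) ∧
  (∀ x y, G.Adj x y → cv x ≠ cv y) ∧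
  (∀ e ∈ G.edgeSet, ∀ f ∈ G.edgeSet, e ≠ f → (∃ x, x ∈ e ∧ x ∈ f) → ce e ≠ ce f) ∧
  (∀ e ∈ G.edgeSet, ∀ x ∈ e, ce e ≠ cv x)

/-- The graph obtained from `G` by deleting the vertices in `S`
(keeping the same ambient vertex type, with deleted vertices isolated). -/
def deleteVertices {V : Type*} (G : SimpleGraph V) (S : Set V) : SimpleGraph V where
  Adj x y := G.Adj x y ∧ x ∉ S ∧ y ∉ S
  symm := by
    refine ⟨?_⟩
    intro x y h
    exact ⟨h.1.symm, h.2.2, h.2.1⟩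
  loopless := by
    refine ⟨?_⟩
    intro x h
    exact G.loopless.irrefl x h.1

/-- `f` dominates `e` when they share an end at which `f` has smaller rank. -/
def Dominates {E A B : Type*} (a : E → A) (b : E → B) (ra rb : E → ℕ) (f e : E) : Prop :=
  (a e = a f ∧ ra f < ra e) ∨ (b e = b f ∧ rb f < rb e)

/-- Every finite family of edges of a bipartite multigraph with ranked stars has a stable
matching. -/
theorem exists_stable_matching {E A B : Type*} [DecidableEq E] (a : E → A) (b : E → B)
    (ra rb : E → ℕ) (ha : ∀ e f, a e = a f → ra e = ra f → e = f)
    (hb : ∀ e f, b e = b f → rb e = rb f → e = f) (S : Finset E) :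
    ∃ M ⊆ S, (∀ e ∈ M, ∀ f ∈ M, a e = a f ∨ b e = b f → e = f) ∧
      ∀ e ∈ S, e ∉ M → ∃ f ∈ M, Dominates a b ra rb f e := by
  classical
  induction S using Finset.strongInduction with
  | H S ih =>
  by_cases hpair : ∃ e ∈ S, ∃ f ∈ S, (∀ g ∈ S, a g = a f → ra f ≤ ra g) ∧
      b e = b f ∧ rb f < rb e
  · obtain ⟨e, he, f, hf, hbest, hbe, hlt⟩ := hpair
    obtain ⟨M, hMS, hind, hdom⟩ := ih (S.erase e) (Finset.erase_ssubset he)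
    refine ⟨M, hMS.trans (Finset.erase_subset _ _), hind, fun g hg hgM => ?_⟩
    by_cases hge : g = e
    · subst hge
      by_cases hfM : f ∈ M
      · exact ⟨f, hfM, Or.inr ⟨hbe, hlt⟩⟩
      · have hfe : f ≠ g := by rintro rfl; exact lt_irrefl _ hlt
        obtain ⟨d, hd, hdf⟩ := hdom f (Finset.mem_erase.2 ⟨hfe, hf⟩) hfM
        refine ⟨d, hd, ?_⟩
        rcases hdf with ⟨h1, h2⟩ | ⟨h1, h2⟩
        · exact absurd (hbest d (Finset.mem_of_mem_erase (hMS hd)) h1.symm) (by omega)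
        · exact Or.inr ⟨hbe.trans h1, h2.trans hlt⟩
    · exact hdom g (Finset.mem_erase.2 ⟨hge, hg⟩) hgM
  · push Not at hpair
    refine ⟨S.filter fun f => ∀ g ∈ S, a g = a f → ra f ≤ ra g, Finset.filter_subset _ _, ?_, ?_⟩
    · intro e he f hf hef
      rw [Finset.mem_filter] at he hf
      rcases hef with h | h
      · exact ha e f h (le_antisymm (he.2 f hf.1 h.symm) (hf.2 e he.1 h))
      · exact hb e f h (le_antisymm (hpair e he.1 f hf.1 hf.2 h)
          (hpair f hf.1 e he.1 he.2 h.symm))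
    · intro e he heM
      obtain ⟨f, hf, hmin⟩ := Finset.exists_min_image (S.filter fun g => a g = a e) ra
        ⟨e, Finset.mem_filter.2 ⟨he, rfl⟩⟩
      rw [Finset.mem_filter] at hf
      have hbest : ∀ g ∈ S, a g = a f → ra f ≤ ra g := fun g hg h =>
        hmin g (Finset.mem_filter.2 ⟨hg, h.trans hf.2⟩)
      refine ⟨f, Finset.mem_filter.2 ⟨hf.1, hbest⟩, Or.inl ⟨hf.2.symm, ?_⟩⟩
      refine lt_of_le_of_ne (hbest e he hf.2.symm) fun h => heM ?_
      rw [← ha f e hf.2 h]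
      exact Finset.mem_filter.2 ⟨hf.1, hbest⟩

open Classical in
/-- Galvin's kernel method for list edge colorings of bipartite multigraphs. -/
theorem exists_list_coloring_of_card_dominates_lt {E A B : Type*} (a : E → A) (b : E → B)
    (ra rb : E → ℕ) (ha : ∀ e f, a e = a f → ra e = ra f → e = f)
    (hb : ∀ e f, b e = b f → rb e = rb f → e = f) (S : Finset E) (L : E → Finset ℕ)
    (hL : ∀ e ∈ S, (S.filter fun f => Dominates a b ra rb f e).card < (L e).card) :
    ∃ c : E → ℕ, (∀ e ∈ S, c e ∈ L e) ∧
      ∀ e ∈ S, ∀ f ∈ S, e ≠ f → a e = a f ∨ b e = b f → c e ≠ c f := by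
  induction S using Finset.strongInduction generalizing L with
  | H S ih =>
  obtain rfl | ⟨e₀, he₀⟩ := S.eq_empty_or_nonempty
  · exact ⟨fun _ => 0, by simp, by simp⟩
  obtain ⟨n, hn⟩ := Finset.card_pos.1 (lt_of_le_of_lt (Nat.zero_le _) (hL e₀ he₀))
  obtain ⟨M, hMS, hind, hdom⟩ :=
    exists_stable_matching a b ra rb ha hb (S.filter fun e => n ∈ L e)
  have hM : ∀ e ∈ M, e ∈ S ∧ n ∈ L e := fun e he => Finset.mem_filter.1 (hMS he)
  have hMne : M.Nonempty := by
    by_contra hne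
    rw [Finset.not_nonempty_iff_eq_empty] at hne
    obtain ⟨f, hf, -⟩ := hdom e₀ (Finset.mem_filter.2 ⟨he₀, hn⟩) (by simp [hne])
    simp [hne] at hf
  have hlt : S \ M ⊂ S := by
    obtain ⟨m, hm⟩ := hMne
    exact Finset.ssubset_iff_subset_ne.2 ⟨Finset.sdiff_subset, fun h =>
      (Finset.mem_sdiff.1 (h.symm ▸ (hM m hm).1 : m ∈ S \ M)).2 hm⟩
  obtain ⟨c, hcL, hc⟩ := ih (S \ M) hlt (fun e => (L e).erase n) (by
    intro e he
    rw [Finset.mem_sdiff] at he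
    have hsub : ((S \ M).filter fun f => Dominates a b ra rb f e) ⊆
        S.filter fun f => Dominates a b ra rb f e :=
      Finset.filter_subset_filter _ Finset.sdiff_subset
    by_cases hne : n ∈ L e
    · obtain ⟨f, hf, hfe⟩ := hdom e (Finset.mem_filter.2 ⟨he.1, hne⟩) he.2
      have hss := Finset.card_lt_card (Finset.ssubset_iff_subset_ne.2 ⟨hsub, fun h =>
        (Finset.mem_sdiff.1 (Finset.mem_filter.1
          (h.symm ▸ Finset.mem_filter.2 ⟨(hM f hf).1, hfe⟩ :
            f ∈ (S \ M).filter fun f => Dominates a b ra rb f e)).1).2 hf⟩)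
      have := hL e he.1
      rw [Finset.card_erase_of_mem hne]
      omega
    · rw [Finset.erase_eq_of_notMem hne]
      exact (Finset.card_le_card hsub).trans_lt (hL e he.1))
  have hne : ∀ e ∈ S, e ∉ M → c e ≠ n := fun e he heM =>
    Finset.ne_of_mem_erase (hcL e (Finset.mem_sdiff.2 ⟨he, heM⟩))
  refine ⟨fun e => if e ∈ M then n else c e, fun e he => ?_, fun e he f hf hef hab => ?_⟩
  · by_cases heM : e ∈ M
    · simpa [heM] using (hM e heM).2
    · simpa [heM] using Finset.mem_of_mem_erase (hcL e (Finset.mem_sdiff.2 ⟨he, heM⟩))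
  · by_cases heM : e ∈ M <;> by_cases hfM : f ∈ M <;> simp only [heM, hfM, if_true, if_false]
    · exact absurd (hind e heM f hfM hab) hef
    · exact (hne f hf hfM).symm
    · exact hne e he heM
    · exact hc e (Finset.mem_sdiff.2 ⟨he, heM⟩) f (Finset.mem_sdiff.2 ⟨hf, hfM⟩) hef hab

/-- The edges of a fan with center `u` and rim path `v₀ x₀ v₁ ⋯ x_{p-1} v_p`. -/
inductive FanEdge (p : ℕ) : Type
  | spoke (i : Fin (p + 1))
  | left (i : Fin p)
  | right (i : Fin p)

namespace FanEdge

variable {p : ℕ}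

/-- The end of a fan edge other than its `v`-end: `none` is the center, `some i` is `x i`. -/
def outer : FanEdge p → Option (Fin p)
  | spoke _ => none
  | left i => some i
  | right i => some i

/-- The index of the `v`-end of a fan edge. -/
def inner : FanEdge p → Fin (p + 1)
  | spoke i => i
  | left i => i.castSucc
  | right i => i.succ

theorem eq_of_ends_eq {s t : FanEdge p} (ho : s.outer = t.outer) (hi : s.inner = t.inner) :
    s = t := by
  cases s <;> cases t <;> simp_all [outer, inner, Fin.ext_iff]

/-- Rank of a fan edge at its outer end. -/
def outerRank : FanEdge p → ℕ
  | spoke i => if (i : ℕ) = 0 then p else i - 1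
  | left _ => 0
  | right _ => 1

/-- Rank of a fan edge at its inner end. -/
def innerRank : FanEdge p → ℕ
  | spoke i => if (i : ℕ) = 0 then 0 else 2
  | left _ => 1
  | right _ => 0

theorem eq_of_outerRank_eq {s t : FanEdge p} (h : s.outer = t.outer)
    (hr : s.outerRank = t.outerRank) : s = t := by
  cases s <;> cases t <;> simp_all [outer, outerRank, Fin.ext_iff, -Fin.val_eq_zero_iff]
  split_ifs at hr <;> omega

theorem eq_of_innerRank_eq {s t : FanEdge p} (h : s.inner = t.inner)
    (hr : s.innerRank = t.innerRank) : s = t := by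
  cases s <;> cases t <;> simp_all [inner, innerRank, Fin.ext_iff, -Fin.val_eq_zero_iff]
  all_goals (split_ifs at hr; omega)

/-- `f` is ranked above `s` at one of the ends of `s`. -/
def Above (f s : FanEdge p) : Prop :=
  Dominates outer inner outerRank innerRank f s

theorem Above.spoke_zero {f : FanEdge p} (h : Above f (spoke 0)) : ∃ j ≠ 0, f = spoke j := by
  cases f <;> simp_all [Above, Dominates, outer, inner, outerRank, innerRank]
  rintro rfl
  simp at h

theorem Above.spoke_of_ne_zero {i : Fin (p + 1)} (hi : (i : ℕ) ≠ 0) {f : FanEdge p}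
    (h : Above f (spoke i)) :
    (∃ j : Fin (p + 1), 1 ≤ (j : ℕ) ∧ j < i ∧ f = spoke j) ∨
      (∃ j : Fin p, (j : ℕ) = i ∧ f = left j) ∨ ∃ j : Fin p, (j : ℕ) + 1 = i ∧ f = right j := by
  cases f with
  | spoke j =>
    refine Or.inl ⟨j, ?_, ?_, rfl⟩ <;>
    · rcases h with ⟨-, h⟩ | ⟨h, h'⟩
      · simp only [outerRank, hi, if_false] at h
        split_ifs at h <;> omega
      · obtain rfl : i = j := h
        exact absurd h' (lt_irrefl _)
  | left j =>
    rcases h with ⟨h, -⟩ | ⟨h, -⟩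
    · simp [outer] at h
    · exact Or.inr (Or.inl ⟨j, by simpa [inner] using congrArg Fin.val h.symm, rfl⟩)
  | right j =>
    rcases h with ⟨h, -⟩ | ⟨h, -⟩
    · simp [outer] at h
    · exact Or.inr (Or.inr ⟨j, by simpa [inner] using congrArg Fin.val h.symm, rfl⟩)

theorem Above.of_left {i : Fin p} {f : FanEdge p} (h : Above f (left i)) :
    ((i : ℕ) = 0 ∧ f = spoke 0) ∨ ∃ j : Fin p, (j : ℕ) + 1 = i ∧ f = right j := by
  rcases h with ⟨-, h⟩ | ⟨h, h'⟩
  · simp [outerRank] at h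
  · have h := congrArg Fin.val h
    cases f <;> simp [inner, innerRank] at h h'
    · refine Or.inl ⟨by simp [h'] at h; omega, congrArg _ h'⟩
    · exact Or.inr ⟨_, h.symm, rfl⟩

theorem Above.of_right {i : Fin p} {f : FanEdge p} (h : Above f (right i)) : f = left i := by
  cases f <;> simp_all [Above, Dominates, outer, inner, outerRank, innerRank]

/-- The edges of a fan can be colored from lists of size `p + 1` on spokes and `2` on rim
edges. -/
theorem exists_list_coloring (hp : 1 ≤ p) (L : FanEdge p → Finset ℕ)
    (hspoke : ∀ i, p + 1 ≤ (L (spoke i)).card) (hleft : ∀ i, 2 ≤ (L (left i)).card)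
    (hright : ∀ i, 2 ≤ (L (right i)).card) :
    ∃ c : FanEdge p → ℕ, (∀ s, c s ∈ L s) ∧
      ∀ s t, s ≠ t → s.outer = t.outer ∨ s.inner = t.inner → c s ≠ c t := by
  classical
  let S : Finset (FanEdge p) := Finset.univ.image spoke ∪ Finset.univ.image left ∪
    Finset.univ.image right
  have hS : ∀ s, s ∈ S := by intro s; cases s <;> simp [S]
  obtain ⟨c, hcL, hc⟩ := exists_list_coloring_of_card_dominates_lt outer inner outerRank
    innerRank (fun _ _ => eq_of_outerRank_eq) (fun _ _ => eq_of_innerRank_eq) S L (by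
    intro s _
    suffices hT : ∃ T : Finset (FanEdge p), T.card < (L s).card ∧ ∀ f, Above f s → f ∈ T by
      obtain ⟨T, hT, hsub⟩ := hT
      exact (Finset.card_le_card fun f hf => hsub f (Finset.mem_filter.1 hf).2).trans_lt hT
    cases s with
    | spoke i =>
      by_cases hi : (i : ℕ) = 0
      · obtain rfl : i = 0 := Fin.ext hi
        refine ⟨(Finset.univ.erase 0).image spoke,
          (Finset.card_image_le.trans (by simp)).trans_lt (hspoke 0), fun f hf => ?_⟩
        obtain ⟨j, hj, rfl⟩ := hf.spoke_zero
        exact Finset.mem_image_of_mem _ (by simp [hj])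
      · have hcard : ((Finset.Ico 1 i).image (spoke (p := p))).card ≤ i - 1 := by
          refine Finset.card_image_le.trans ?_
          rw [Fin.card_Ico, Fin.val_one', Nat.mod_eq_of_lt (by omega)]
        have hone : ((1 : Fin (p + 1)) : ℕ) = 1 := by
          rw [Fin.val_one', Nat.mod_eq_of_lt (by omega)]
        have hLi := hspoke i
        by_cases hl : (i : ℕ) < p
        · refine ⟨(Finset.Ico 1 i).image spoke ∪ {left ⟨i, hl⟩, right ⟨i - 1, by omega⟩},
            (Finset.card_union_le _ _).trans_lt ?_, fun f hf => ?_⟩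
          · have := Finset.card_le_two (a := left ⟨i, hl⟩) (b := right ⟨i - 1, by omega⟩)
            omega
          · obtain ⟨j, h1, h2, rfl⟩ | ⟨j, h1, rfl⟩ | ⟨j, h1, rfl⟩ := hf.spoke_of_ne_zero hi
            · refine Finset.mem_union_left _ (Finset.mem_image_of_mem _ (Finset.mem_Ico.2 ⟨?_, h2⟩))
              rw [Fin.le_def]
              omega
            · obtain rfl : j = ⟨i, hl⟩ := Fin.ext h1
              simp
            · have hji : j = ⟨i - 1, by omega⟩ := Fin.ext (by simp; omega)
              simp [hji]
        · refine ⟨(Finset.Ico 1 i).image spoke ∪ {right ⟨i - 1, by omega⟩},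
            (Finset.card_union_le _ _).trans_lt ?_, fun f hf => ?_⟩
          · rw [Finset.card_singleton]
            omega
          · obtain ⟨j, h1, h2, rfl⟩ | ⟨j, h1, rfl⟩ | ⟨j, h1, rfl⟩ := hf.spoke_of_ne_zero hi
            · refine Finset.mem_union_left _ (Finset.mem_image_of_mem _ (Finset.mem_Ico.2 ⟨?_, h2⟩))
              rw [Fin.le_def]
              omega
            · omega
            · have hji : j = ⟨i - 1, by omega⟩ := Fin.ext (by simp; omega)
              simp [hji]
    | left i =>
      by_cases hi : (i : ℕ) = 0
      · refine ⟨{spoke 0}, (hleft i).trans_lt' (by simp), fun f hf => ?_⟩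
        obtain ⟨-, rfl⟩ | ⟨j, hj, -⟩ := hf.of_left
        · simp
        · omega
      · refine ⟨{right ⟨i - 1, by omega⟩}, (hleft i).trans_lt' (by simp), fun f hf => ?_⟩
        obtain ⟨h, -⟩ | ⟨j, hj, rfl⟩ := hf.of_left
        · omega
        · have hji : j = ⟨i - 1, by omega⟩ := Fin.ext (by simp; omega)
          simp [hji]
    | right i =>
      exact ⟨{left i}, (hright i).trans_lt' (by simp), fun f hf => by simp [hf.of_right]⟩)
  exact ⟨c, fun s => hcL s (hS s), fun s t => hc s (hS s) t (hS t)⟩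

end FanEdge

namespace FanEdge

variable {p : ℕ} {V : Type*} {u : V} {v : Fin (p + 1) → V} {x : Fin p → V}

/-- The outer end of a fan edge, as a vertex. -/
def outerVertex (u : V) (x : Fin p → V) (s : FanEdge p) : V :=
  s.outer.elim u x

/-- A fan edge as an unordered pair of vertices. -/
def toSym2 (u : V) (v : Fin (p + 1) → V) (x : Fin p → V) (s : FanEdge p) : Sym2 V :=
  s(s.outerVertex u x, v s.inner)

theorem outerVertex_notMem_range (huv : ∀ i, u ≠ v i) (hvx : ∀ i j, v i ≠ x j)
    (s : FanEdge p) : s.outerVertex u x ∉ Set.range v := by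
  rintro ⟨i, hi⟩
  cases s
  · exact huv i hi.symm
  · exact hvx i _ hi
  · exact hvx i _ hi

theorem outer_eq_of_outerVertex_eq (hx : Function.Injective x) (hux : ∀ i, u ≠ x i)
    {s t : FanEdge p} (h : s.outerVertex u x = t.outerVertex u x) : s.outer = t.outer := by
  unfold outerVertex at h
  cases hs : s.outer <;> cases ht : t.outer <;> simp only [hs, ht, Option.elim] at h
  · rfl
  · exact absurd h (hux _)
  · exact absurd h.symm (hux _)
  · rw [hx h]

theorem toSym2_injective (hv : Function.Injective v) (hx : Function.Injective x)
    (huv : ∀ i, u ≠ v i) (hux : ∀ i, u ≠ x i) (hvx : ∀ i j, v i ≠ x j) :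
    Function.Injective (toSym2 u v x) := by
  intro s t h
  rcases Sym2.eq_iff.1 h with ⟨h1, h2⟩ | ⟨h1, -⟩
  · exact eq_of_ends_eq (outer_eq_of_outerVertex_eq hx hux h1) (hv h2)
  · exact absurd ⟨_, h1.symm⟩ (outerVertex_notMem_range huv hvx s)

end FanEdge

open FanEdge

/-- A set of neighbors as large as the degree contains every neighbor. -/
theorem mem_of_adj_of_degree_le_card {V : Type*} [Fintype V] (G : SimpleGraph V)
    [DecidableRel G.Adj] {w y : V} (T : Finset V) (hT : ∀ z ∈ T, G.Adj w z)
    (hcard : G.degree w ≤ T.card) (hy : G.Adj w y) : y ∈ T := by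
  have hsub : T ⊆ G.neighborFinset w := fun z hz => by simpa using hT z hz
  rw [Finset.eq_of_subset_of_card_le hsub (by simpa using hcard)]
  simpa using hy

/-- The edges at the inner vertices of a fan whose inner vertices have no other neighbors. -/
theorem mem_range_toSym2 {V : Type*} [Fintype V] [DecidableEq V]
    (G : SimpleGraph V) [DecidableRel G.Adj] {p : ℕ} (hp : 1 ≤ p) {u : V} {v : Fin (p + 1) → V}
    {x : Fin p → V} (hx : Function.Injective x) (hux : ∀ i, u ≠ x i)
    (hadju : ∀ i : Fin (p + 1), G.Adj u (v i))
    (hadj : ∀ i : Fin p, G.Adj (v i.castSucc) (x i) ∧ G.Adj (x i) (v i.succ))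
    (hdeg1 : G.degree (v 0) = 2) (hdeg2 : G.degree (v (Fin.last p)) = 2)
    (hdeg3 : ∀ i : Fin (p + 1), i ≠ 0 → i ≠ Fin.last p → G.degree (v i) = 3)
    {e : Sym2 V} (he : e ∈ G.edgeSet) {i : Fin (p + 1)} (hi : v i ∈ e) :
    e ∈ Set.range (toSym2 u v x) := by
  obtain ⟨y, rfl⟩ := hi
  have hy : G.Adj (v i) y := he
  have hu : s(v i, u) ∈ Set.range (toSym2 u v x) := ⟨spoke i, Sym2.eq_swap⟩
  have hl : ∀ j : Fin p, j.castSucc = i → s(v i, x j) ∈ Set.range (toSym2 u v x) := by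
    rintro j rfl
    exact ⟨left j, Sym2.eq_swap⟩
  have hr : ∀ j : Fin p, j.succ = i → s(v i, x j) ∈ Set.range (toSym2 u v x) := by
    rintro j rfl
    exact ⟨right j, Sym2.eq_swap⟩
  have hal : ∀ j : Fin p, j.castSucc = i → G.Adj (v i) (x j) := by
    rintro j rfl
    exact (hadj j).1
  have har : ∀ j : Fin p, j.succ = i → G.Adj (v i) (x j) := by
    rintro j rfl
    exact (hadj j).2.symm
  by_cases h0 : i = 0
  · have hj : (⟨0, hp⟩ : Fin p).castSucc = i := by rw [h0]; rfl
    have hmem : y ∈ ({u, x ⟨0, hp⟩} : Finset V) := by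
      refine mem_of_adj_of_degree_le_card G _ ?_ ?_ hy
      · simp [(hadju i).symm, hal _ hj]
      · rw [Finset.card_pair (hux _), h0, hdeg1]
    simp only [Finset.mem_insert, Finset.mem_singleton] at hmem
    obtain rfl | rfl := hmem
    exacts [hu, hl _ hj]
  have hi0 : 0 < (i : ℕ) := Nat.pos_of_ne_zero fun h => h0 (Fin.ext h)
  have hj : (⟨i - 1, by omega⟩ : Fin p).succ = i := Fin.ext (by simp; omega)
  by_cases hlast : i = Fin.last p
  · have hmem : y ∈ ({u, x ⟨i - 1, by omega⟩} : Finset V) := by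
      refine mem_of_adj_of_degree_le_card G _ ?_ ?_ hy
      · simp [(hadju i).symm, har _ hj]
      · rw [Finset.card_pair (hux _), hlast, hdeg2]
    simp only [Finset.mem_insert, Finset.mem_singleton] at hmem
    obtain rfl | rfl := hmem
    exacts [hu, hr _ hj]
  · have hip : (i : ℕ) < p :=
      lt_of_le_of_ne (Nat.lt_succ_iff.1 i.2) fun h => hlast (Fin.ext h)
    have hj' : (⟨i, hip⟩ : Fin p).castSucc = i := rfl
    have hmem : y ∈ ({u, x ⟨i, hip⟩, x ⟨i - 1, by omega⟩} : Finset V) := by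
      refine mem_of_adj_of_degree_le_card G _ ?_ ?_ hy
      · simp [(hadju i).symm, har _ hj, hal _ hj']
      · rw [hdeg3 i h0 hlast, Finset.card_eq_three.2 ⟨_, _, _, hux _, hux _, ?_, rfl⟩]
        exact hx.ne (by simp; omega)
    simp only [Finset.mem_insert, Finset.mem_singleton] at hmem
    obtain rfl | rfl | rfl := hmem
    exacts [hu, hl _ hj', hr _ hj]

/-- The colors at `w` and on the edges at `w` outside `R` that are no longer available on edges of
`R` at `w`. -/
noncomputable def usedColors {V : Type*} [Fintype V] [DecidableEq V] (G : SimpleGraph V)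
    [DecidableRel G.Adj] (cv : V → ℕ) (ce : Sym2 V → ℕ) (R : Finset (Sym2 V)) (w : V) : Finset ℕ :=
  insert (cv w) ((G.incidenceFinset w \ R).image ce)

theorem card_usedColors_add_le {V : Type*} [Fintype V] [DecidableEq V] (G : SimpleGraph V)
    [DecidableRel G.Adj] (cv : V → ℕ) (ce : Sym2 V → ℕ) (R T : Finset (Sym2 V)) (w : V)
    (hTR : T ⊆ R) (hT : T ⊆ G.incidenceFinset w) :
    (usedColors G cv ce R w).card + T.card ≤ G.degree w + 1 := by
  have h1 : (usedColors G cv ce R w).card ≤ (G.incidenceFinset w \ R).card + 1 :=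
    (Finset.card_insert_le _ _).trans (Nat.succ_le_succ Finset.card_image_le)
  have h2 : (G.incidenceFinset w \ R).card ≤ (G.incidenceFinset w \ T).card :=
    Finset.card_le_card (Finset.sdiff_subset_sdiff subset_rfl hTR)
  have h3 := Finset.card_sdiff_add_card_eq_card hT
  rw [G.card_incidenceFinset_eq_degree] at h3
  omega

/-- `v : Fin (p+1) → V` encodes the vertices `v_1, …, v_{p+1}` and
`x : Fin p → V` encodes the vertices `x_1, …, x_p` (zero-indexed). -/
theorem stmt_5 {V : Type*} [Fintype V] [DecidableEq V]
    (G : SimpleGraph V) [DecidableRel G.Adj]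
    (k : ℕ) (hk : 7 ≤ k) (hΔ : ∀ w, G.degree w ≤ k)
    (p : ℕ) (hp : 1 ≤ p) (u : V) (v : Fin (p + 1) → V) (x : Fin p → V)
    (hv : Function.Injective v) (hx : Function.Injective x)
    (huv : ∀ i, u ≠ v i) (hux : ∀ i, u ≠ x i) (hvx : ∀ i j, v i ≠ x j)
    (hadju : ∀ i : Fin (p + 1), G.Adj u (v i))
    (hadj : ∀ i : Fin p, G.Adj (v i.castSucc) (x i) ∧ G.Adj (x i) (v i.succ))
    (hdeg1 : G.degree (v 0) = 2) (hdeg2 : G.degree (v (Fin.last p)) = 2)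
    (hdeg3 : ∀ i : Fin (p + 1), i ≠ 0 → i ≠ Fin.last p → G.degree (v i) = 3)
    (Lv : V → Finset ℕ) (Le : Sym2 V → Finset ℕ)
    (hLv : ∀ w, k + 1 ≤ (Lv w).card)
    (hLe : ∀ e ∈ G.edgeSet, k + 1 ≤ (Le e).card)
    (h : ∃ cv ce, IsProperTotalColoring (deleteVertices G (Set.range v)) Lv Le cv ce) :
    ∃ cv ce, IsProperTotalColoring G Lv Le cv ce := by
  obtain ⟨cv, ce, hcv, hceL, hvv, hee, hev⟩ := h
  let φ : FanEdge p → Sym2 V := toSym2 u v x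
  have hφ : Function.Injective φ := toSym2_injective hv hx huv hux hvx
  have hout : ∀ s : FanEdge p, s.outerVertex u x ∉ Set.range v :=
    outerVertex_notMem_range huv hvx
  have hφG : ∀ s, φ s ∈ G.edgeSet := by
    rintro (i | i | i)
    exacts [hadju i, (hadj i).1.symm, (hadj i).2]
  have hat : ∀ e ∈ G.edgeSet, ∀ y ∈ e, y ∈ Set.range v → e ∈ Set.range φ := by
    rintro e he _ hy ⟨i, rfl⟩
    exact mem_range_toSym2 G hp hx hux hadju hadj hdeg1 hdeg2 hdeg3 he hy
  have hdel : ∀ e ∈ G.edgeSet, e ∉ Set.range φ →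
      e ∈ (deleteVertices G (Set.range v)).edgeSet := by
    intro e he hne
    induction e with
    | _ y z =>
      exact ⟨he, fun hy => hne (hat _ he y (by simp) hy), fun hz => hne (hat _ he z (by simp) hz)⟩
  have hdegv : ∀ i, G.degree (v i) ≤ 3 := by
    intro i
    by_cases h0 : i = 0
    · rw [h0, hdeg1]; omega
    by_cases h1 : i = Fin.last p
    · rw [h1, hdeg2]; omega
    exact (hdeg3 i h0 h1).le
  classical
  let R : Finset (Sym2 V) := (Set.toFinite (Set.range φ)).toFinset
  have hR : ∀ e, e ∈ R ↔ e ∈ Set.range φ := fun e => Set.Finite.mem_toFinset _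
  let U : V → Finset ℕ := usedColors G cv ce R
  have hinc : ∀ s, φ s ∈ G.incidenceFinset (s.outerVertex u x) := fun s => by
    rw [SimpleGraph.mem_incidenceFinset]
    exact ⟨hφG s, Sym2.mem_mk_left _ _⟩
  have hUu : (U u).card + (p + 1) ≤ k + 1 := by
    have hcard : ((Finset.univ : Finset (Fin (p + 1))).image fun i => φ (spoke i)).card = p + 1 := by
      rw [Finset.card_image_of_injective _ (fun i j h => by simpa using hφ h), Finset.card_univ,
        Fintype.card_fin]
    have := card_usedColors_add_le G cv ce R
      ((Finset.univ : Finset (Fin (p + 1))).image fun i => φ (spoke i)) u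
      (fun e he => by
        obtain ⟨i, -, rfl⟩ := Finset.mem_image.1 he
        exact (hR _).2 ⟨_, rfl⟩)
      (fun e he => by
        obtain ⟨i, -, rfl⟩ := Finset.mem_image.1 he
        exact hinc (spoke i))
    rw [hcard] at this
    exact this.trans (Nat.succ_le_succ (hΔ u))
  have hUx : ∀ i, (U (x i)).card + 2 ≤ k + 1 := by
    intro i
    have hcard : ({φ (left i), φ (right i)} : Finset (Sym2 V)).card = 2 :=
      Finset.card_pair (hφ.ne (by simp))
    have := card_usedColors_add_le G cv ce R {φ (left i), φ (right i)} (x i)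
      (fun e he => by
        obtain rfl | rfl : e = φ (left i) ∨ e = φ (right i) := by simpa using he
        exacts [(hR _).2 ⟨_, rfl⟩, (hR _).2 ⟨_, rfl⟩])
      (fun e he => by
        obtain rfl | rfl : e = φ (left i) ∨ e = φ (right i) := by simpa using he
        exacts [hinc (left i), hinc (right i)])
    rw [hcard] at this
    exact this.trans (Nat.succ_le_succ (hΔ _))
  have hLcard : ∀ s, k + 1 ≤ (Le (φ s) \ U (s.outerVertex u x)).card +
      (U (s.outerVertex u x)).card := fun s =>
    (hLe _ (hφG s)).trans (tsub_le_iff_right.1 (Finset.le_card_sdiff _ _))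
  obtain ⟨c, hcL, hc⟩ := FanEdge.exists_list_coloring hp
    (fun s => Le (φ s) \ U (s.outerVertex u x))
    (fun i => by
      have h1 : k + 1 ≤ (Le (φ (spoke i)) \ U u).card + (U u).card := hLcard (spoke i)
      change p + 1 ≤ (Le (φ (spoke i)) \ U u).card
      omega)
    (fun i => by
      have h1 : k + 1 ≤ (Le (φ (left i)) \ U (x i)).card + (U (x i)).card := hLcard (left i)
      have := hUx i
      change 2 ≤ (Le (φ (left i)) \ U (x i)).card
      omega)
    (fun i => by
      have h1 : k + 1 ≤ (Le (φ (right i)) \ U (x i)).card + (U (x i)).card := hLcard (right i)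
      have := hUx i
      change 2 ≤ (Le (φ (right i)) \ U (x i)).card
      omega)
  simp only [Finset.mem_sdiff] at hcL
  let ce' : Sym2 V → ℕ := Function.extend φ c ce
  have hce' : ∀ s, ce' (φ s) = c s := fun s => hφ.extend_apply c ce s
  have hce'_of : ∀ e, e ∉ Set.range φ → ce' e = ce e := fun e he =>
    Function.extend_apply' c ce e he
  have hchoice : ∀ i, ∃ n ∈ Lv (v i), n ∉ (G.neighborFinset (v i)).image cv ∪
      (G.incidenceFinset (v i)).image ce' := by
    intro i
    by_contra hcon
    push Not at hcon
    have h1 := (Finset.card_le_card hcon).trans (Finset.card_union_le _ _)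
    have h2 : ((G.neighborFinset (v i)).image cv).card ≤ 3 :=
      Finset.card_image_le.trans (by simpa using hdegv i)
    have h3 : ((G.incidenceFinset (v i)).image ce').card ≤ 3 :=
      Finset.card_image_le.trans (by simpa using hdegv i)
    have h4 := hLv (v i)
    omega
  choose n hnL hn using hchoice
  simp only [Finset.mem_union, Finset.mem_image, SimpleGraph.mem_neighborFinset,
    SimpleGraph.mem_incidenceFinset, not_or, not_exists, not_and] at hn
  let cv' : V → ℕ := Function.extend v n cv
  have hcv' : ∀ i, cv' (v i) = n i := fun i => hv.extend_apply n cv i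
  have hcv'_of : ∀ w, w ∉ Set.range v → cv' w = cv w := fun w hw =>
    Function.extend_apply' n cv w hw
  have hnbr : ∀ i y, G.Adj (v i) y → y ∉ Set.range v := by
    rintro i y hy hyv
    obtain ⟨s, hs⟩ := hat s(v i, y) hy (v i) (by simp) ⟨i, rfl⟩
    have hmem : s.outerVertex u x ∈ s(v i, y) := hs ▸ Sym2.mem_mk_left _ _
    rcases Sym2.mem_iff.1 hmem with h | h
    · exact hout s (h ▸ ⟨i, rfl⟩)
    · exact hout s (h ▸ hyv)
  have hmem_outer : ∀ s, ∀ y ∈ φ s, y ∉ Set.range v → y = s.outerVertex u x := by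
    intro s y hy hyv
    rcases Sym2.mem_iff.1 hy with h | h
    · exact h
    · exact absurd ⟨_, h.symm⟩ hyv
  have hold : ∀ s, ∀ f ∈ G.edgeSet, f ∉ Set.range φ → ∀ y ∈ φ s, y ∈ f → c s ≠ ce f := by
    intro s f hf hfφ y hys hyf hcs
    have hy := hmem_outer s y hys fun hyv => hfφ (hat f hf y hyf hyv)
    refine (hcL s).2 (hcs ▸ Finset.mem_insert_of_mem (Finset.mem_image_of_mem ce ?_))
    rw [Finset.mem_sdiff, SimpleGraph.mem_incidenceFinset, hR]
    exact ⟨⟨hf, hy ▸ hyf⟩, hfφ⟩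
  refine ⟨cv', ce', fun w => ?_, fun e he => ?_, fun y z hyz => ?_, fun e he f hf hef => ?_,
    fun e he y hy => ?_⟩
  · by_cases hw : w ∈ Set.range v
    · obtain ⟨i, rfl⟩ := hw
      rw [hcv']
      exact hnL i
    · rw [hcv'_of w hw]
      exact hcv w
  · by_cases heφ : e ∈ Set.range φ
    · obtain ⟨s, rfl⟩ := heφ
      rw [hce']
      exact (hcL s).1
    · rw [hce'_of e heφ]
      exact hceL e (hdel e he heφ)
  · by_cases hy : y ∈ Set.range v
    · obtain ⟨i, rfl⟩ := hy
      rw [hcv', hcv'_of z (hnbr i z hyz)]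
      exact fun h => (hn i).1 z hyz h.symm
    by_cases hz : z ∈ Set.range v
    · obtain ⟨i, rfl⟩ := hz
      rw [hcv', hcv'_of y hy]
      exact (hn i).1 y hyz.symm
    rw [hcv'_of y hy, hcv'_of z hz]
    exact hvv y z ⟨hyz, hy, hz⟩
  · rintro ⟨y, hye, hyf⟩
    by_cases heφ : e ∈ Set.range φ <;> by_cases hfφ : f ∈ Set.range φ
    · obtain ⟨s, rfl⟩ := heφ
      obtain ⟨t, rfl⟩ := hfφ
      rw [hce', hce']
      refine hc s t (fun h => hef (h ▸ rfl)) ?_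
      by_cases hyv : y ∈ Set.range v
      · right
        rcases Sym2.mem_iff.1 hye with h1 | h1
        · exact absurd (h1 ▸ hyv) (hout s)
        rcases Sym2.mem_iff.1 hyf with h2 | h2
        · exact absurd (h2 ▸ hyv) (hout t)
        exact hv (h1.symm.trans h2)
      · exact Or.inl (outer_eq_of_outerVertex_eq hx hux
          ((hmem_outer s y hye hyv).symm.trans (hmem_outer t y hyf hyv)))
    · obtain ⟨s, rfl⟩ := heφ
      rw [hce', hce'_of f hfφ]
      exact hold s f hf hfφ y hye hyf
    · obtain ⟨t, rfl⟩ := hfφ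
      rw [hce', hce'_of e heφ]
      exact (hold t e he heφ y hyf hye).symm
    · rw [hce'_of e heφ, hce'_of f hfφ]
      exact hee e (hdel e he heφ) f (hdel f hf hfφ) hef ⟨y, hye, hyf⟩
  · by_cases hyv : y ∈ Set.range v
    · obtain ⟨i, rfl⟩ := hyv
      rw [hcv']
      exact (hn i).2 e ⟨he, hy⟩
    rw [hcv'_of y hyv]
    by_cases heφ : e ∈ Set.range φ
    · obtain ⟨s, rfl⟩ := heφ
      rw [hce', hmem_outer s y hy hyv]
      exact fun h => (hcL s).2 (h ▸ Finset.mem_insert_self _ _)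
    · rw [hce'_of e heφ]
      exact hev e (hdel e he heφ) y hy
end

section
/- Let k ≥ 7 be a natural number and let G be a finite simple graph with maximum degree at most k. Suppose G contains pairwise distinct vertices u, v_1, …, v_p, x_1, …, x_{p-1} with p ≥ 3 such that: every v_i (1 ≤ i ≤ p) is adjacent to u; v_1 has degree exactly 2 and its two neighbors are u and x_1; x_i v_{i+1} and v_{i+1} x_{i+1} are edges of G for all 1 ≤ i ≤ p−2, x_{p-1} v_p and v_p x_1 are edges of G (so that x_1, v_2, x_2, …, x_{p-1}, v_p form a cycle); and d(v_i) = 3 for all 2 ≤ i ≤ p. Let L be a list assignment on the edges of G with |L(e)| ≥ k for every edge e. Then every proper L-edge-coloring of the graph obtained from G by deleting the vertices v_1, …, v_p extends to a proper L-edge-coloring of G (agreeing with the given coloring on all edges not incident to any v_i). -/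
/-- A proper `L`-edge-coloring of `G`: every edge of `G` gets a color from its list,
and any two distinct edges of `G` sharing an endpoint receive distinct colors. -/
def IsProperEdgeColoring {V : Type*} (G : SimpleGraph V)
    (L : Sym2 V → Finset ℕ) (c : Sym2 V → ℕ) : Prop :=
  (∀ e ∈ G.edgeSet, c e ∈ L e) ∧
  ∀ e ∈ G.edgeSet, ∀ f ∈ G.edgeSet, e ≠ f → (∃ x, x ∈ e ∧ x ∈ f) → c e ≠ c f

open Finset in
/-- Stable matchings: in a finite set `F` of edges of a bipartite multigraph, with `f` and `g`
ranking the edges at each left and right vertex, there is a matching such that every other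
edge is beaten at one of its ends by an edge of the matching. -/
theorem exists_stable_matching_s6 {E A B : Type*} [DecidableEq E] (l : E → A) (r : E → B)
    (f g : E → ℕ) (F : Finset E)
    (hf : ∀ e ∈ F, ∀ e' ∈ F, l e = l e' → f e = f e' → e = e')
    (hg : ∀ e ∈ F, ∀ e' ∈ F, r e = r e' → g e = g e' → e = e') :
    ∃ M ⊆ F, (∀ e ∈ M, ∀ e' ∈ M, e ≠ e' → l e ≠ l e' ∧ r e ≠ r e') ∧
      ∀ e ∈ F, e ∉ M → ∃ e' ∈ M, (l e' = l e ∧ f e' < f e) ∨ (r e' = r e ∧ g e' < g e) := by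
  classical
  induction F using Finset.strongInduction with
  | H F ih =>
  by_cases h : ∃ e ∈ F, ∃ e' ∈ F, (∀ d ∈ F, l d = l e → f e ≤ f d) ∧ r e = r e' ∧ g e < g e'
  · obtain ⟨e, he, e', he', hbest, hr, hlt⟩ := h
    obtain ⟨M, hMF, hM, hdom⟩ := ih (F.erase e') (erase_ssubset he')
      (fun a ha b hb ↦ hf a (mem_of_mem_erase ha) b (mem_of_mem_erase hb))
      (fun a ha b hb ↦ hg a (mem_of_mem_erase ha) b (mem_of_mem_erase hb))
    refine ⟨M, hMF.trans (erase_subset _ _), hM, fun d hd hdM ↦ ?_⟩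
    by_cases hde : d = e'
    · subst hde
      by_cases heM : e ∈ M
      · exact ⟨e, heM, .inr ⟨hr, hlt⟩⟩
      · obtain ⟨a, ha, ⟨h1, h2⟩ | ⟨h1, h2⟩⟩ :=
          hdom e (mem_erase.2 ⟨fun h ↦ by simp [h] at hlt, he⟩) heM
        · exact absurd (hbest a (mem_of_mem_erase (hMF ha)) h1) (by omega)
        · exact ⟨a, ha, .inr ⟨h1.trans hr, h2.trans hlt⟩⟩
    · exact hdom d (mem_erase.2 ⟨hde, hd⟩) hdM
  · push Not at h
    refine ⟨F.filter fun e ↦ ∀ d ∈ F, l d = l e → f e ≤ f d, filter_subset _ _, ?_, ?_⟩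
    · intro e he e' he' hne
      rw [mem_filter] at he he'
      refine ⟨fun hl ↦ hne (hf e he.1 e' he'.1 hl ?_), fun hr ↦ hne (hg e he.1 e' he'.1 hr ?_)⟩
      · exact le_antisymm (he.2 e' he'.1 hl.symm) (he'.2 e he.1 hl)
      · exact le_antisymm (h e' he'.1 e he.1 he'.2 hr.symm) (h e he.1 e' he'.1 he.2 hr)
    · intro e he heM
      obtain ⟨a, ha, hmin⟩ := exists_min_image (F.filter fun d ↦ l d = l e) f ⟨e, by simp [he]⟩
      rw [mem_filter] at ha
      have haM : a ∈ F.filter fun e ↦ ∀ d ∈ F, l d = l e → f e ≤ f d :=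
        mem_filter.2 ⟨ha.1, fun d hd hda ↦ hmin d (mem_filter.2 ⟨hd, hda.trans ha.2⟩)⟩
      refine ⟨a, haM, .inl ⟨ha.2, lt_of_le_of_ne (hmin e (by simp [he])) fun hfe ↦ heM ?_⟩⟩
      rwa [← hf a ha.1 e he ha.2 hfe]

open Finset in
/-- Galvin's method: a bipartite multigraph can be edge-colored from lists such that
each edge has more colors than edges that beat it at one of its two ends. -/
theorem exists_list_edge_coloring_of_card_lt {E A B : Type*} [DecidableEq E] [DecidableEq A]
    [DecidableEq B] (l : E → A) (r : E → B) (f g : E → ℕ) (F : Finset E)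
    (hf : ∀ e ∈ F, ∀ e' ∈ F, l e = l e' → f e = f e' → e = e')
    (hg : ∀ e ∈ F, ∀ e' ∈ F, r e = r e' → g e = g e' → e = e') (L : E → Finset ℕ)
    (hL : ∀ e ∈ F, #{d ∈ F | l d = l e ∧ f d < f e} + #{d ∈ F | r d = r e ∧ g d < g e} < #(L e)) :
    ∃ c : E → ℕ, (∀ e ∈ F, c e ∈ L e) ∧
      ∀ e ∈ F, ∀ e' ∈ F, e ≠ e' → (l e = l e' ∨ r e = r e') → c e ≠ c e' := by
  induction F using Finset.strongInduction generalizing L with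
  | H F ih =>
  obtain rfl | ⟨e₀, he₀⟩ := F.eq_empty_or_nonempty
  · exact ⟨fun _ ↦ 0, by simp, by simp⟩
  obtain ⟨a, ha⟩ : (L e₀).Nonempty := card_pos.1 (by have := hL e₀ he₀; omega)
  obtain ⟨M, hMF, hM, hdom⟩ := exists_stable_matching_s6 l r f g {e ∈ F | a ∈ L e}
    (fun e he e' he' ↦ hf e (mem_filter.1 he).1 e' (mem_filter.1 he').1)
    (fun e he e' he' ↦ hg e (mem_filter.1 he).1 e' (mem_filter.1 he').1)
  have hMF' : M ⊆ F := hMF.trans (filter_subset _ _)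
  have hMne : M.Nonempty := by
    by_cases h : e₀ ∈ M
    · exact ⟨_, h⟩
    · obtain ⟨d, hd, -⟩ := hdom e₀ (by simp [he₀, ha]) h
      exact ⟨d, hd⟩
  obtain ⟨c, hcL, hc⟩ := ih (F \ M) (sdiff_ssubset hMF' hMne)
    (fun e he e' he' ↦ hf e (mem_sdiff.1 he).1 e' (mem_sdiff.1 he').1)
    (fun e he e' he' ↦ hg e (mem_sdiff.1 he).1 e' (mem_sdiff.1 he').1)
    (fun e ↦ (L e).erase a) (by
      intro e he
      obtain ⟨heF, heM⟩ := mem_sdiff.1 he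
      have hlt := hL e heF
      have hl : {d ∈ F \ M | l d = l e ∧ f d < f e} ⊆ {d ∈ F | l d = l e ∧ f d < f e} :=
        filter_subset_filter _ sdiff_subset
      have hr : {d ∈ F \ M | r d = r e ∧ g d < g e} ⊆ {d ∈ F | r d = r e ∧ g d < g e} :=
        filter_subset_filter _ sdiff_subset
      have hl' := card_le_card hl
      have hr' := card_le_card hr
      by_cases hae : a ∈ L e
      · rw [card_erase_of_mem hae]
        obtain ⟨d, hd, h | h⟩ := hdom e (by simp [heF, hae]) heM
        · have := card_lt_card ((ssubset_iff_of_subset hl).2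
            ⟨d, by simp [hMF' hd, h], by simp [hd]⟩)
          omega
        · have := card_lt_card ((ssubset_iff_of_subset hr).2
            ⟨d, by simp [hMF' hd, h], by simp [hd]⟩)
          omega
      · rw [erase_eq_of_notMem hae]
        omega)
  refine ⟨fun e ↦ if e ∈ M then a else c e, fun e he ↦ ?_, fun e he e' he' hne hadj ↦ ?_⟩
  · by_cases h : e ∈ M
    · simpa [h] using (mem_filter.1 (hMF h)).2
    · simpa [h] using mem_of_mem_erase (hcL e (by simp [he, h]))
  · by_cases h : e ∈ M <;> by_cases h' : e' ∈ M
    · have := hM e h e' h' hne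
      tauto
    · simpa [h, h'] using (ne_of_mem_erase (hcL e' (by simp [he', h']))).symm
    · simpa [h, h'] using ne_of_mem_erase (hcL e (by simp [he, h]))
    · simpa [h, h'] using hc e (by simp [he, h]) e' (by simp [he', h']) hne hadj

open Finset in
theorem exists_list_edge_coloring_of_rank {E A B : Type*} [DecidableEq E] [DecidableEq A]
    [DecidableEq B] (l : E → A) (r : E → B) (f g : E → ℕ) (F : Finset E)
    (hf : ∀ e ∈ F, ∀ e' ∈ F, l e = l e' → f e = f e' → e = e')
    (hg : ∀ e ∈ F, ∀ e' ∈ F, r e = r e' → g e = g e' → e = e') (L : E → Finset ℕ)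
    (hL : ∀ e ∈ F, f e + g e < #(L e)) :
    ∃ c : E → ℕ, (∀ e ∈ F, c e ∈ L e) ∧
      ∀ e ∈ F, ∀ e' ∈ F, e ≠ e' → (l e = l e' ∨ r e = r e') → c e ≠ c e' := by
  refine exists_list_edge_coloring_of_card_lt l r f g F hf hg L fun e he ↦
    (Nat.add_le_add ?_ ?_).trans_lt (hL e he)
  · refine (card_le_card_of_injOn f (t := range (f e)) (fun d hd ↦ ?_) ?_).trans
      (card_range _).le
    · simp_all
    · intro d hd d' hd' h
      simp only [coe_filter, Set.mem_ofPred_eq] at hd hd'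
      exact hf d hd.1 d' hd'.1 (hd.2.1.trans hd'.2.1.symm) h
  · refine (card_le_card_of_injOn g (t := range (g e)) (fun d hd ↦ ?_) ?_).trans
      (card_range _).le
    · simp_all
    · intro d hd d' hd' h
      simp only [coe_filter, Set.mem_ofPred_eq] at hd hd'
      exact hg d hd.1 d' hd'.1 (hd.2.1.trans hd'.2.1.symm) h

open Finset in
/-- Let `Y` enumerate an independent set of vertices whose neighbors are among the `X i`. If the
edges `X i — Y j` are ranked at both ends so that the two ranks of each edge add up to less than
the number of `Y`-neighbors of `X i`, then list edge-colorings extend to the vertices `Y j`. -/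
theorem exists_extension_of_rank {V : Type*} [Fintype V] [DecidableEq V]
    {G : SimpleGraph V} [DecidableRel G.Adj] {k : ℕ} (hΔ : ∀ w, G.degree w ≤ k)
    {ι κ : Type*} [Fintype ι] [Fintype κ] [DecidableEq ι] [DecidableEq κ]
    {X : ι → V} {Y : κ → V} (hX : Function.Injective X) (hY : Function.Injective Y)
    (hXY : ∀ i j, X i ≠ Y j) (hnbr : ∀ j w, G.Adj (Y j) w → ∃ i, w = X i)
    (f g : ι → κ → ℕ)
    (hf : ∀ i j j', G.Adj (X i) (Y j) → G.Adj (X i) (Y j') → f i j = f i j' → j = j')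
    (hg : ∀ i i' j, G.Adj (X i) (Y j) → G.Adj (X i') (Y j) → g i j = g i' j → i = i')
    (hfg : ∀ i j, G.Adj (X i) (Y j) → f i j + g i j < #{j' | G.Adj (X i) (Y j')})
    (L : Sym2 V → Finset ℕ) (hL : ∀ e ∈ G.edgeSet, k ≤ (L e).card)
    (c' : Sym2 V → ℕ)
    (hc' : IsProperEdgeColoring (deleteVertices G (Set.range Y)) L c') :
    ∃ c : Sym2 V → ℕ, IsProperEdgeColoring G L c ∧
      ∀ e ∈ (deleteVertices G (Set.range Y)).edgeSet, c e = c' e := by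
  classical
  set φ : ι × κ → Sym2 V := fun e ↦ s(X e.1, Y e.2) with hφ
  have hφinj : Function.Injective φ := by
    rintro ⟨i, j⟩ ⟨i', j'⟩ h
    rcases Sym2.eq_iff.1 h with ⟨h1, h2⟩ | ⟨h1, -⟩
    · exact Prod.ext (hX h1) (hY h2)
    · exact absurd h1 (hXY _ _)
  set N : ι → Finset V := fun i ↦ {w ∈ G.neighborFinset (X i) | w ∉ Set.range Y} with hN
  have hNcard (i : ι) : #(N i) + #{j | G.Adj (X i) (Y j)} ≤ k := by
    refine le_trans ?_ (hΔ (X i))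
    rw [← G.card_neighborFinset_eq_degree, ← card_image_of_injective _ hY, ← card_union_of_disjoint]
    · refine card_le_card fun w hw ↦ ?_
      simp only [hN, mem_union, mem_filter, mem_image, mem_univ, true_and,
        SimpleGraph.mem_neighborFinset] at hw ⊢
      rcases hw with hw | ⟨j, hj, rfl⟩
      exacts [hw.1, hj]
    · rw [disjoint_left]
      intro w hw hw'
      obtain ⟨j, -, rfl⟩ := mem_image.1 hw'
      exact (mem_filter.1 hw).2 ⟨j, rfl⟩
  obtain ⟨d, hdL, hd⟩ := exists_list_edge_coloring_of_rank (Prod.fst : ι × κ → ι) Prod.snd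
    (fun e ↦ f e.1 e.2) (fun e ↦ g e.1 e.2) {e : ι × κ | G.Adj (X e.1) (Y e.2)}
    (by
      rintro ⟨i, j⟩ he ⟨i', j'⟩ he' (rfl : i = i') h
      rw [hf i j j' (by simpa using he) (by simpa using he') h])
    (by
      rintro ⟨i, j⟩ he ⟨i', j'⟩ he' (rfl : j = j') h
      rw [hg i i' j (by simpa using he) (by simpa using he') h])
    (fun e ↦ L (φ e) \ (N e.1).image fun w ↦ c' s(X e.1, w))
    (by
      rintro ⟨i, j⟩ he
      have he : G.Adj (X i) (Y j) := by simpa using he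
      have h1 := hfg i j he
      have h2 := hNcard i
      have h3 := hL (φ (i, j)) he
      have h4 := card_image_le (s := N i) (f := fun w ↦ c' s(X i, w))
      have h5 := le_card_sdiff ((N i).image fun w ↦ c' s(X i, w)) (L (φ (i, j)))
      dsimp only
      omega)
  have hold : ∀ e ∈ (deleteVertices G (Set.range Y)).edgeSet, Function.extend φ d c' e = c' e := by
    intro e he
    refine Function.extend_apply' _ _ _ ?_
    rintro ⟨⟨i, j⟩, rfl⟩
    exact he.2.2 ⟨j, rfl⟩
  have hcases : ∀ e ∈ G.edgeSet, e ∈ (deleteVertices G (Set.range Y)).edgeSet ∨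
      ∃ i j, G.Adj (X i) (Y j) ∧ e = φ (i, j) := by
    intro e
    induction e with | _ a b
    intro (hab : G.Adj a b)
    by_cases ha : a ∈ Set.range Y
    · obtain ⟨j, rfl⟩ := ha
      obtain ⟨i, rfl⟩ := hnbr j b hab
      exact .inr ⟨i, j, hab.symm, Sym2.eq_swap⟩
    by_cases hb : b ∈ Set.range Y
    · obtain ⟨j, rfl⟩ := hb
      obtain ⟨i, rfl⟩ := hnbr j a hab.symm
      exact .inr ⟨i, j, hab, rfl⟩
    exact .inl ⟨hab, ha, hb⟩
  have hmixed : ∀ e ∈ (deleteVertices G (Set.range Y)).edgeSet, ∀ i j, G.Adj (X i) (Y j) →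
      (∃ z, z ∈ e ∧ z ∈ φ (i, j)) → d (i, j) ≠ c' e := by
    rintro e he i j hij ⟨z, hze, hz⟩ heq
    obtain ⟨w, rfl⟩ := Sym2.mem_iff_exists.1 hze
    have he : G.Adj z w ∧ z ∉ Set.range Y ∧ w ∉ Set.range Y := he
    rcases Sym2.mem_iff.1 hz with rfl | rfl
    · refine (mem_sdiff.1 (hdL (i, j) (by simpa using hij))).2 (mem_image.2 ⟨w, ?_, heq.symm⟩)
      simpa [hN] using And.intro he.1 he.2.2
    · exact he.2.1 ⟨j, rfl⟩
  refine ⟨Function.extend φ d c', ⟨fun e he ↦ ?_, fun e he e' he' hne hadj ↦ ?_⟩, hold⟩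
  · rcases hcases e he with h | ⟨i, j, h, rfl⟩
    · rw [hold e h]
      exact hc'.1 e h
    · rw [hφinj.extend_apply]
      exact (mem_sdiff.1 (hdL (i, j) (by simpa using h))).1
  · rcases hcases e he with h | ⟨i, j, h, rfl⟩ <;>
      rcases hcases e' he' with h' | ⟨i', j', h', rfl⟩
    · rw [hold e h, hold e' h']
      exact hc'.2 e h e' h' hne hadj
    · rw [hold e h, hφinj.extend_apply]
      exact (hmixed e h i' j' h' hadj).symm
    · rw [hold e' h', hφinj.extend_apply]
      exact hmixed e' h' i j h (hadj.imp fun _ ↦ And.symm)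
    · rw [hφinj.extend_apply, hφinj.extend_apply]
      refine hd _ (by simpa using h) _ (by simpa using h') (fun h ↦ hne (congrArg φ h)) ?_
      obtain ⟨z, hz, hz'⟩ := hadj
      rcases Sym2.mem_iff.1 hz with rfl | rfl <;> rcases Sym2.mem_iff.1 hz' with h | h
      · exact .inl (hX h)
      · exact absurd h (hXY _ _)
      · exact absurd h.symm (hXY _ _)
      · exact .inr (hY h)

/-- Rank of the edge joining the `i`-th of `u, x₁, …, x_q` to `v_j`, at the former vertex. -/
def outerRank (q i j : ℕ) : ℕ :=
  if i = 0 then (if j = 0 then q else j - 1)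
  else if i = 1 then (if j = q then 0 else j + 1)
  else if j = i then 1 else 0

/-- Rank of the edge joining the `i`-th of `u, x₁, …, x_q` to `v_j`, at `v_j`. -/
def innerRank (q i j : ℕ) : ℕ :=
  if j = 0 then i
  else if i = 0 then (if j = q then 1 else 2)
  else if i = j then 0 else if j = q then 2 else 1

/-- Here `p = q + 1 ≥ 3`: `v : Fin (q+1) → V` encodes the vertices `v_1, …, v_p`
and `x : Fin q → V` encodes the vertices `x_1, …, x_{p-1}` (zero-indexed).
The cycle `x_1, v_2, x_2, …, x_{p-1}, v_p` is given by the edges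
`x_j v_{j+1}` (`hcyc1`), `v_{j+1} x_{j+1}` for `j ≤ p-2` (`hcyc2`),
and `v_p x_1` (`hcyc3`). -/
theorem stmt_6 {V : Type*} [Fintype V] [DecidableEq V]
    (G : SimpleGraph V) [DecidableRel G.Adj]
    (k : ℕ) (hk : 7 ≤ k) (hΔ : ∀ w, G.degree w ≤ k)
    (q : ℕ) (hq : 2 ≤ q) (u : V) (v : Fin (q + 1) → V) (x : Fin q → V)
    (hv : Function.Injective v) (hx : Function.Injective x)
    (huv : ∀ i, u ≠ v i) (hux : ∀ i, u ≠ x i) (hvx : ∀ i j, v i ≠ x j)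
    (hadju : ∀ i : Fin (q + 1), G.Adj u (v i))
    (hnbr : G.degree (v 0) = 2 ∧ (G.neighborSet (v 0) = {u, x ⟨0, by omega⟩}))
    (hcyc1 : ∀ i : Fin q, G.Adj (x i) (v i.succ))
    (hcyc2 : ∀ i : Fin q, i ≠ ⟨0, by omega⟩ → G.Adj (v i.castSucc) (x i))
    (hcyc3 : G.Adj (v (Fin.last q)) (x ⟨0, by omega⟩))
    (hdeg : ∀ i : Fin (q + 1), i ≠ 0 → G.degree (v i) = 3)
    (L : Sym2 V → Finset ℕ) (hL : ∀ e ∈ G.edgeSet, k ≤ (L e).card)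
    (c' : Sym2 V → ℕ)
    (hc' : IsProperEdgeColoring (deleteVertices G (Set.range v)) L c') :
    ∃ c : Sym2 V → ℕ, IsProperEdgeColoring G L c ∧
      ∀ e ∈ (deleteVertices G (Set.range v)).edgeSet, c e = c' e := by
  classical
  set X : Fin (q + 1) → V := Fin.cons u x with hXdef
  have hX : Function.Injective X := by
    rw [hXdef, Fin.cons_injective_iff]
    exact ⟨fun ⟨i, hi⟩ ↦ hux i hi.symm, hx⟩
  have hXY : ∀ i j, X i ≠ v j := by
    intro i j
    cases i using Fin.cases with
    | zero => exact huv j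
    | succ i => exact (hvx j i).symm
  have hXx (i : Fin (q + 1)) (hi : i.val ≠ 0) : X i = x ⟨i - 1, by omega⟩ := by
    cases i using Fin.cases with
    | zero => simp at hi
    | succ i => simp [hXdef]
  have hdiag (i : Fin (q + 1)) (hi : i.val ≠ 0) : G.Adj (X i) (v i) := by
    cases i using Fin.cases with
    | zero => simp at hi
    | succ i => exact hcyc1 i
  have hfst (j : Fin (q + 1)) : G.Adj (X 0) (v j) := hadju j
  have hzero : G.Adj (X ⟨1, by omega⟩) (v 0) := by
    have : x ⟨0, by omega⟩ ∈ G.neighborSet (v 0) := by simp [hnbr.2]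
    simpa [hXx] using G.adj_symm this
  have hlast : G.Adj (X ⟨1, by omega⟩) (v (Fin.last q)) := by
    simpa [hXx] using hcyc3.symm
  have hnext (i j : Fin (q + 1)) (hj : j.val ≠ 0) (hij : i.val = j + 1) : G.Adj (X i) (v j) := by
    have := hcyc2 ⟨j, by omega⟩ fun h ↦ hj (congrArg Fin.val h)
    rw [hXx i (by omega)]
    simpa [hij] using this.symm
  have hnbrs (j : Fin (q + 1)) (w : V) (hw : G.Adj (v j) w) : ∃ i : Fin (q + 1), w = X i ∧
      (i.val = 0 ∨ (i.val = 1 ∧ j.val = 0) ∨ (i.val = 1 ∧ j.val = q) ∨ (i.val = j ∧ j.val ≠ 0) ∨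
        (i.val = j + 1 ∧ j.val ≠ 0)) := by
    by_cases hj : j.val = 0
    · obtain rfl : j = 0 := Fin.ext hj
      have hw : w ∈ G.neighborSet (v 0) := hw
      rw [hnbr.2] at hw
      rcases hw with rfl | hw
      · exact ⟨0, rfl, by simp⟩
      · refine ⟨⟨1, by omega⟩, ?_, by simp⟩
        rw [hXx _ (by simp)]
        exact hw
    · have hthree (i : Fin (q + 1)) (hi : i.val ≠ 0) (hij : i ≠ j) (hadj : G.Adj (X i) (v j)) :
          w = X 0 ∨ w = X j ∨ w = X i := by
        have hcard : ({X 0, X j, X i} : Finset V).card = 3 := by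
          rw [Finset.card_eq_three]
          refine ⟨_, _, _, ?_, ?_, ?_, rfl⟩ <;> apply hX.ne <;> grind
        have hsub : {X 0, X j, X i} ⊆ G.neighborFinset (v j) := by
          intro z hz
          simp only [Finset.mem_insert, Finset.mem_singleton] at hz
          rw [SimpleGraph.mem_neighborFinset]
          rcases hz with rfl | rfl | rfl
          exacts [(hfst j).symm, (hdiag j hj).symm, hadj.symm]
        have heq := Finset.eq_of_subset_of_card_le hsub (by
          rw [hcard, G.card_neighborFinset_eq_degree, hdeg j fun h ↦ hj (congrArg Fin.val h)])
        have hw : w ∈ G.neighborFinset (v j) := by simpa using hw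
        simpa [← heq] using hw
      by_cases hjq : j.val = q
      · obtain rfl : j = Fin.last q := Fin.ext hjq
        rcases hthree ⟨1, by omega⟩ (by simp) (by simp [Fin.ext_iff]; omega) hlast with h | h | h
        · exact ⟨_, h, by simp⟩
        · exact ⟨_, h, by simp; omega⟩
        · exact ⟨_, h, by simp⟩
      · rcases hthree ⟨j + 1, by omega⟩ (by simp) (by simp [Fin.ext_iff])
          (hnext _ _ hj rfl) with h | h | h
        · exact ⟨_, h, by simp⟩
        · exact ⟨_, h, by simp [hj]⟩
        · exact ⟨_, h, by simp [hj]⟩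
  have hadj (i j : Fin (q + 1)) (h : G.Adj (X i) (v j)) : i.val = 0 ∨ (i.val = 1 ∧ j.val = 0) ∨
      (i.val = 1 ∧ j.val = q) ∨ (i.val = j ∧ j.val ≠ 0) ∨ (i.val = j + 1 ∧ j.val ≠ 0) := by
    obtain ⟨i', hi', h'⟩ := hnbrs j (X i) h.symm
    rwa [hX hi']
  refine exists_extension_of_rank hΔ hX hv hXY
    (fun j w hw ↦ (hnbrs j w hw).imp fun _ ↦ And.left)
    (fun i j ↦ outerRank q i j) (fun i j ↦ innerRank q i j) ?_ ?_ ?_ L hL c' hc'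
  · intro i j j' h h' heq
    have h1 := hadj i j h
    have h2 := hadj i j' h'
    apply Fin.ext
    dsimp only [outerRank] at heq
    split_ifs at heq <;> omega
  · intro i i' j h h' heq
    have h1 := hadj i j h
    have h2 := hadj i' j h'
    apply Fin.ext
    dsimp only [innerRank] at heq
    split_ifs at heq <;> omega
  · intro i j h
    have h1 := hadj i j h
    by_cases hi0 : i.val = 0
    · obtain rfl : i = 0 := Fin.ext hi0
      have : (Finset.univ.filter fun j' ↦ G.Adj (X 0) (v j')).card = q + 1 := by
        simp [hfst]
      rw [this]
      dsimp only [outerRank, innerRank]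
      split_ifs <;> simp_all <;> omega
    by_cases hi1 : i.val = 1
    · have hlt : outerRank q i j + innerRank q i j < 3 := by
        dsimp only [outerRank, innerRank]
        split_ifs <;> omega
      have hone : 1 < q + 1 := by omega
      obtain rfl : i = ⟨1, hone⟩ := Fin.ext hi1
      have hcard : ({0, ⟨1, by omega⟩, Fin.last q} : Finset (Fin (q + 1))).card = 3 := by
        rw [Finset.card_eq_three]
        refine ⟨_, _, _, ?_, ?_, ?_, rfl⟩ <;> simp [Fin.ext_iff] <;> omega
      have hle := Finset.card_le_card (s := {0, ⟨1, by omega⟩, Fin.last q})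
        (t := Finset.univ.filter fun j' ↦ G.Adj (X ⟨1, by omega⟩) (v j')) (by
          intro z hz
          simp only [Finset.mem_insert, Finset.mem_singleton] at hz
          rw [Finset.mem_filter]
          rcases hz with rfl | rfl | rfl
          exacts [⟨Finset.mem_univ _, hzero⟩, ⟨Finset.mem_univ _, hdiag _ (by simp)⟩,
            ⟨Finset.mem_univ _, hlast⟩])
      rw [hcard] at hle
      exact hlt.trans_le hle
    · have hcard : ({⟨i - 1, by omega⟩, i} : Finset (Fin (q + 1))).card = 2 := by
        apply Finset.card_pair
        simp [Fin.ext_iff]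
        omega
      have hle := Finset.card_le_card (s := {⟨i - 1, by omega⟩, i})
        (t := Finset.univ.filter fun j' ↦ G.Adj (X i) (v j')) (by
          intro z hz
          simp only [Finset.mem_insert, Finset.mem_singleton] at hz
          rw [Finset.mem_filter]
          rcases hz with rfl | rfl
          · exact ⟨Finset.mem_univ _, hnext _ _ (by dsimp only; omega) (by dsimp only; omega)⟩
          · exact ⟨Finset.mem_univ _, hdiag _ hi0⟩)
      rw [hcard] at hle
      refine lt_of_lt_of_le ?_ hle
      dsimp only [outerRank, innerRank]
      split_ifs <;> omega
end
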